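/- Let T1 and T2 be finite non-trivial trees with diam(T1) ≥ diam(T2), and let r1 be a central vertex of T1. Then the Hausdorff distance H(T1, T2) equals the minimum over all vertices u of T2 of the distance between the covers of an optimal top-down amalgam of T1 rooted at r1 and T2 rooted at u. -/

import Mathlib

namespace HDTrees

open SimpleGraph Set

/-- A vertex set `S` is convex in `G`: the induced subgraph is connected and every
shortest path between vertices of `S` stays inside `S`. -/
def ConvexIn {V : Type*} (G : SimpleGraph V) (S : Set V) : Prop :=
  (G.induce S).Connected ∧
    ∀ u ∈ S, ∀ v ∈ S, ∀ p : G.Walk u v, p.length = G.dist u v →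
      ∀ x ∈ p.support, x ∈ S

/-- `A` is an amalgam of `G₁` and `G₂` along the embeddings `f₁`, `f₂`:
the two covers exhaust the vertices and edges of `A`, and the intersection of the
covers corresponds to a convex subgraph on each side. -/
structure IsAmalgam {V₁ V₂ W : Type*} (G₁ : SimpleGraph V₁) (G₂ : SimpleGraph V₂)
    (A : SimpleGraph W) (f₁ : G₁ ↪g A) (f₂ : G₂ ↪g A) : Prop where
  vcover : Set.range ⇑f₁ ∪ Set.range ⇑f₂ = Set.univ
  ecover : ∀ x y : W, A.Adj x y →
    (x ∈ Set.range ⇑f₁ ∧ y ∈ Set.range ⇑f₁) ∨ (x ∈ Set.range ⇑f₂ ∧ y ∈ Set.range ⇑f₂)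
  conv₁ : ConvexIn G₁ (⇑f₁ ⁻¹' Set.range ⇑f₂)
  conv₂ : ConvexIn G₂ (⇑f₂ ⁻¹' Set.range ⇑f₁)

/-- Distance from a vertex to a set of vertices. -/
noncomputable def distToSet {W : Type*} (A : SimpleGraph W) (u : W) (S : Set W) : ℕ :=
  sInf (A.dist u '' S)

/-- The distance between the covers of an amalgam `A` whose intersection has
vertex set `S`: the maximum over vertices of `A` of the distance to `S`. -/
noncomputable def coverDist {W : Type*} (A : SimpleGraph W) (S : Set W) : ℕ :=
  sSup (Set.range fun u => distToSet A u S)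

open scoped Classical in
/-- The Hausdorff distance between two graphs. -/
noncomputable def hausdorffDist {V₁ V₂ : Type*} (G₁ : SimpleGraph V₁)
    (G₂ : SimpleGraph V₂) : ℕ :=
  if Nonempty (G₁ ≃g G₂) then 0
  else sInf {n : ℕ | ∃ (W : Type) (A : SimpleGraph W) (f₁ : G₁ ↪g A) (f₂ : G₂ ↪g A),
    Finite W ∧ IsAmalgam G₁ G₂ A f₁ f₂ ∧
      coverDist A (Set.range ⇑f₁ ∩ Set.range ⇑f₂) = n}

/-- Eccentricity of a vertex. -/
noncomputable def ecc {V : Type*} (G : SimpleGraph V) (v : V) : ℕ := sSup (Set.range (G.dist v))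

/-- Radius of a graph. -/
noncomputable def grad {V : Type*} (G : SimpleGraph V) : ℕ := sInf (Set.range (ecc G))

/-- Diameter of a graph. -/
noncomputable def gdiam {V : Type*} (G : SimpleGraph V) : ℕ := sSup (Set.range (ecc G))

/-- In the tree `T` rooted at `r`, `p` is the parent of `v`. -/
def IsParent {V : Type*} (T : SimpleGraph V) (r p v : V) : Prop :=
  T.Adj v p ∧ T.dist r p + 1 = T.dist r v

/-- The set of children of `v` in the tree `T` rooted at `r`. -/
def childSet {V : Type*} (T : SimpleGraph V) (r v : V) : Set V := {u | IsParent T r v u}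

/-- The vertex set of the subtree rooted at `v` (i.e. `v` and its descendants)
in the tree `T` rooted at `r`. -/
def subtreeSet {V : Type*} (T : SimpleGraph V) (r v : V) : Set V :=
  {u | T.dist r u = T.dist r v + T.dist v u}

lemma mem_subtreeSet_self {V : Type*} (T : SimpleGraph V) (r v : V) :
    v ∈ subtreeSet T r v := by simp [subtreeSet]

/-- The height of the vertex `v` in the tree `T` rooted at `r`. -/
noncomputable def heightV {V : Type*} (T : SimpleGraph V) (r v : V) : ℕ :=
  sSup (T.dist v '' subtreeSet T r v)

/-- The distance between the covers of an optimal top-down amalgam of the rooted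
trees `(T₁, r₁)` and `(T₂, r₂)`: the minimum of the distance between the covers
over all amalgams identifying the two roots. -/
noncomputable def topDownDist {V₁ V₂ : Type*} (T₁ : SimpleGraph V₁) (r₁ : V₁)
    (T₂ : SimpleGraph V₂) (r₂ : V₂) : ℕ :=
  sInf {n : ℕ | ∃ (W : Type) (A : SimpleGraph W) (f₁ : T₁ ↪g A) (f₂ : T₂ ↪g A),
    Finite W ∧ IsAmalgam T₁ T₂ A f₁ f₂ ∧ f₁ r₁ = f₂ r₂ ∧
      coverDist A (Set.range ⇑f₁ ∩ Set.range ⇑f₂) = n}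

/-- `D(x, y)`: the distance between the covers of an optimal top-down amalgam of
the subtree of `(T₁, r₁)` rooted at `x` and the subtree of `(T₂, r₂)` rooted at `y`. -/
noncomputable def subtreeDist {V₁ V₂ : Type*} (T₁ : SimpleGraph V₁) (r₁ : V₁)
    (T₂ : SimpleGraph V₂) (r₂ : V₂) (x : V₁) (y : V₂) : ℕ :=
  topDownDist (T₁.induce (subtreeSet T₁ r₁ x)) ⟨x, mem_subtreeSet_self T₁ r₁ x⟩
    (T₂.induce (subtreeSet T₂ r₂ y)) ⟨y, mem_subtreeSet_self T₂ r₂ y⟩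

/-- `S` is (the vertex set of) a top-down subtree of the tree `T` rooted at `r`. -/
def IsTopDown {V : Type*} (T : SimpleGraph V) (r : V) (S : Set V) : Prop :=
  r ∈ S ∧ ∀ v ∈ S, v ≠ r → ∀ p : V, IsParent T r p v → p ∈ S

/-- `M` is a rooted tree isomorphism (as a set of pairs) between subsets of the rooted
trees `(T₁, r₁)` and `(T₂, r₂)`: it is functional and injective in both coordinates,
matches the roots and maps parents to parents. -/
def IsRootedIso {V₁ V₂ : Type*} (T₁ : SimpleGraph V₁) (r₁ : V₁)
    (T₂ : SimpleGraph V₂) (r₂ : V₂) (M : Set (V₁ × V₂)) : Prop :=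
  (r₁, r₂) ∈ M ∧
  (∀ v w w', (v, w) ∈ M → (v, w') ∈ M → w = w') ∧
  (∀ v v' w, (v, w) ∈ M → (v', w) ∈ M → v = v') ∧
  (∀ v w, (v, w) ∈ M → (v = r₁ ↔ w = r₂)) ∧
  (∀ v w, (v, w) ∈ M → ∀ pv, IsParent T₁ r₁ pv v → ∀ pw, IsParent T₂ r₂ pw w →
    (pv, pw) ∈ M)

/-- The inductive description of the reconstructed mapping `M ⊆ M'`:
`(r₁, r₂) ∈ M`, and a pair of non-root vertices lies in `M` iff it lies in `M'`
and the pair of parents lies in `M`. -/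
def ReconFix {V₁ V₂ : Type*} (T₁ : SimpleGraph V₁) (r₁ : V₁)
    (T₂ : SimpleGraph V₂) (r₂ : V₂) (M' M : Set (V₁ × V₂)) : Prop :=
  ∀ v w, (v, w) ∈ M ↔ ((v, w) ∈ M' ∧
    ((v = r₁ ∧ w = r₂) ∨ (v ≠ r₁ ∧ w ≠ r₂ ∧
      ∃ pv pw, IsParent T₁ r₁ pv v ∧ IsParent T₂ r₂ pw w ∧ (pv, pw) ∈ M)))

lemma exists_adj_dist_eq_add_one {V : Type*} {T : SimpleGraph V} (hT : T.IsTree) {r s : V}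
    (h : r ≠ s) : ∃ p, T.Adj r p ∧ T.dist r s = T.dist p s + 1 := by
  obtain ⟨w, hw⟩ := hT.connected.exists_walk_length_eq_dist r s
  cases w with
  | nil => exact absurd rfl h
  | @cons _ p _ hadj w =>
    refine ⟨p, hadj, ?_⟩
    have h1 := T.dist_le w
    have h2 := hT.dist_eq_dist_add_one_of_adj s hadj
    rw [T.dist_comm (u := s), T.dist_comm (u := s)] at h2
    rw [Walk.length_cons] at hw
    omega

lemma eq_of_adj_of_dist_add_one_eq {V : Type*} {T : SimpleGraph V} (hT : T.IsTree)
    {y a a' b : V} (ha : T.Adj a b) (ha' : T.Adj a' b) (h : T.dist y a + 1 = T.dist y b)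
    (h' : T.dist y a' + 1 = T.dist y b) : a = a' := by
  obtain ⟨w, hw⟩ := hT.connected.exists_walk_length_eq_dist y a
  obtain ⟨w', hw'⟩ := hT.connected.exists_walk_length_eq_dist y a'
  have hp : (w.concat ha).IsPath :=
    Walk.isPath_of_length_eq_dist _ (by rw [Walk.length_concat, hw, h])
  have hp' : (w'.concat ha').IsPath :=
    Walk.isPath_of_length_eq_dist _ (by rw [Walk.length_concat, hw', h'])
  have := (hT.existsUnique_path y b).unique hp hp'
  simpa using congrArg Walk.penultimate this

/-- Geodesics of a tree that leave an edge in opposite directions join to a geodesic. -/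
lemma dist_eq_of_adj_of_dist_eq {V : Type*} {T : SimpleGraph V} (hT : T.IsTree) {y s r p : V}
    (hadj : T.Adj r p) (hy : T.dist y p = T.dist y r + 1) (hs : T.dist r s = T.dist p s + 1) :
    T.dist y s = T.dist y r + 1 + T.dist p s := by
  induction hn : T.dist p s generalizing r p with
  | zero =>
    obtain rfl := hT.connected.dist_eq_zero_iff.mp hn
    exact hy
  | succ n ih =>
    have hne : p ≠ s := by
      rintro rfl
      simp at hn
    obtain ⟨q, hq, hqs⟩ := exists_adj_dist_eq_add_one hT hne
    have hqr : q ≠ r := by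
      rintro rfl
      omega
    have hyq : T.dist y q = T.dist y p + 1 := by
      rcases hT.dist_eq_dist_add_one_of_adj y hq with h | h
      · exact absurd (eq_of_adj_of_dist_add_one_eq hT hq.symm hadj h.symm hy.symm) hqr
      · exact h
    have := ih hq hyq hqs (by omega)
    omega

lemma dist_le_ecc {V : Type*} [Finite V] (T : SimpleGraph V) (v w : V) : T.dist v w ≤ ecc T v :=
  le_csSup (Set.finite_range _).bddAbove ⟨w, rfl⟩

lemma exists_dist_eq_ecc {V : Type*} [Finite V] (T : SimpleGraph V) (v : V) :
    ∃ w, T.dist v w = ecc T v := by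
  have : Nonempty V := ⟨v⟩
  exact Nat.sSup_mem (Set.range_nonempty _) (Set.finite_range _).bddAbove

lemma grad_le_ecc {V : Type*} (T : SimpleGraph V) (v : V) : grad T ≤ ecc T v :=
  Nat.sInf_le ⟨v, rfl⟩

lemma exists_ecc_eq_grad {V : Type*} [Nonempty V] (T : SimpleGraph V) : ∃ v, ecc T v = grad T :=
  Nat.sInf_mem (Set.range_nonempty (ecc T))

lemma dist_le_gdiam {V : Type*} [Finite V] (T : SimpleGraph V) (v w : V) :
    T.dist v w ≤ gdiam T :=
  (dist_le_ecc T v w).trans (le_csSup (Set.finite_range _).bddAbove ⟨v, rfl⟩)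

lemma gdiam_le_two_mul_ecc {V : Type*} [Finite V] {T : SimpleGraph V} (hT : T.Connected) (c : V) :
    gdiam T ≤ 2 * ecc T c := by
  refine csSup_le' ?_
  rintro _ ⟨v, rfl⟩
  refine csSup_le' ?_
  rintro _ ⟨w, rfl⟩
  have h := hT.dist_triangle (u := v) (v := c) (w := w)
  have h1 := dist_le_ecc T c v
  have h2 := dist_le_ecc T c w
  rw [T.dist_comm] at h1
  omega

/-- From every neighbour `p` of a central vertex `c` there is a vertex at distance at least the
radius which lies on the side of `c`. -/
lemma exists_dist_ge_grad_of_adj {V : Type*} [Finite V] {T : SimpleGraph V} (hT : T.IsTree)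
    {c p : V} (hc : ecc T c = grad T) (hadj : T.Adj c p) :
    ∃ y, T.dist y p = T.dist y c + 1 ∧ grad T ≤ T.dist y p := by
  obtain ⟨y, hy⟩ := exists_dist_eq_ecc T p
  have h1 := grad_le_ecc T p
  have h2 := dist_le_ecc T c y
  have h3 := hT.dist_eq_dist_add_one_of_adj y hadj
  rw [T.dist_comm] at hy h2
  refine ⟨y, ?_, ?_⟩ <;> omega

lemma two_mul_grad_le {V : Type*} [Finite V] {T : SimpleGraph V} (hT : T.IsTree) :
    2 * grad T ≤ gdiam T + 1 := by
  have := hT.connected.nonempty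
  obtain ⟨c, hc⟩ := exists_ecc_eq_grad T
  obtain ⟨s, hs⟩ := exists_dist_eq_ecc T c
  rcases eq_or_ne c s with rfl | hne
  · rw [T.dist_self] at hs
    omega
  obtain ⟨p, hadj, hp⟩ := exists_adj_dist_eq_add_one hT hne
  obtain ⟨y, hy, hge⟩ := exists_dist_ge_grad_of_adj hT hc hadj
  have h1 := dist_eq_of_adj_of_dist_eq hT hadj hy hp
  have h2 := dist_le_gdiam T y s
  omega

/-- If a convex set misses a central vertex, then some vertex has distance at least the radius
from it. -/
lemma ConvexIn.exists_forall_grad_le_dist {V : Type*} [Finite V] {T : SimpleGraph V}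
    (hT : T.IsTree) {c : V} (hc : ecc T c = grad T) {S : Set V} (hS : ConvexIn T S)
    (hcS : c ∉ S) : ∃ y, ∀ s ∈ S, grad T ≤ T.dist y s := by
  obtain ⟨s, hs⟩ := hS.1.nonempty
  have hne : c ≠ s := by
    rintro rfl
    exact hcS hs
  obtain ⟨p, hadj, hp⟩ := exists_adj_dist_eq_add_one hT hne
  obtain ⟨y, hy, hge⟩ := exists_dist_ge_grad_of_adj hT hc hadj
  refine ⟨y, fun t ht => ?_⟩
  rcases hT.dist_eq_dist_add_one_of_adj t hadj with h | h
  · rw [T.dist_comm (u := t), T.dist_comm (u := t)] at h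
    have := dist_eq_of_adj_of_dist_eq hT hadj hy h
    omega
  · have h1 := dist_eq_of_adj_of_dist_eq hT hadj h hp
    obtain ⟨w, hw⟩ := hT.connected.exists_walk_length_eq_dist t c
    obtain ⟨w', hw'⟩ := hT.connected.exists_walk_length_eq_dist c s
    refine absurd (hS.2 t ht s hs (w.append w') ?_ c ?_) hcS
    · rw [Walk.length_append]
      omega
    · simp

lemma distToSet_le {W : Type*} (A : SimpleGraph W) (u : W) {S : Set W} {s : W} (hs : s ∈ S) :
    distToSet A u S ≤ A.dist u s :=
  Nat.sInf_le ⟨s, hs, rfl⟩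

lemma distToSet_le_coverDist {W : Type*} [Finite W] (A : SimpleGraph W) (u : W) (S : Set W) :
    distToSet A u S ≤ coverDist A S :=
  le_csSup (Set.finite_range _).bddAbove ⟨u, rfl⟩

lemma dist_map_le {V W : Type*} {G : SimpleGraph V} {A : SimpleGraph W} (hG : G.Connected)
    (f : G ↪g A) (a b : V) : A.dist (f a) (f b) ≤ G.dist a b := by
  obtain ⟨w, hw⟩ := hG.exists_walk_length_eq_dist a b
  rw [← hw, ← Walk.length_map f.toHom w]
  exact A.dist_le _

namespace IsAmalgam

variable {V₁ V₂ W : Type*} {G₁ : SimpleGraph V₁} {G₂ : SimpleGraph V₂} {A : SimpleGraph W}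
  {f₁ : G₁ ↪g A} {f₂ : G₂ ↪g A}

lemma exists_dist_le_length (h : IsAmalgam G₁ G₂ A f₁ f₂) (hG₁ : G₁.Connected) {x z : W}
    (w : A.Walk x z) (hz : z ∈ Set.range f₁ ∩ Set.range f₂) (a : V₁) (ha : f₁ a = x) :
    ∃ s ∈ ⇑f₁ ⁻¹' Set.range ⇑f₂, G₁.dist a s ≤ w.length := by
  induction w generalizing a with
  | nil =>
    subst ha
    exact ⟨a, hz.2, by simp⟩
  | @cons x x' z hadj w ih =>
    by_cases hx : x ∈ Set.range f₂
    · exact ⟨a, by simpa [ha] using hx, by simp⟩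
    · rcases h.ecover _ _ hadj with ⟨-, a', rfl⟩ | ⟨h', -⟩
      · obtain ⟨s, hs, hle⟩ := ih hz a' rfl
        subst ha
        have h1 : G₁.dist a a' = 1 := dist_eq_one_iff_adj.mpr (f₁.map_adj_iff.mp hadj)
        have h2 := hG₁.dist_triangle (u := a) (v := a') (w := s)
        exact ⟨s, hs, by rw [Walk.length_cons]; omega⟩
      · exact absurd h' hx

lemma le_coverDist [Finite W] (h : IsAmalgam G₁ G₂ A f₁ f₂) (hG₁ : G₁.Connected) {y : V₁} {n : ℕ}
    (hy : ∀ s ∈ ⇑f₁ ⁻¹' Set.range ⇑f₂, n ≤ G₁.dist y s) :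
    n ≤ coverDist A (Set.range ⇑f₁ ∩ Set.range ⇑f₂) := by
  refine le_trans ?_ (distToSet_le_coverDist A (f₁ y) _)
  obtain ⟨s₀, hs₀⟩ := h.conv₁.1.nonempty
  have hne : (A.dist (f₁ y) '' (Set.range ⇑f₁ ∩ Set.range ⇑f₂)).Nonempty :=
    ⟨_, f₁ s₀, ⟨⟨s₀, rfl⟩, hs₀⟩, rfl⟩
  obtain ⟨z, hz, hzd⟩ := Nat.sInf_mem hne
  rw [distToSet, ← hzd]
  obtain ⟨t, rfl⟩ := hz.1
  obtain ⟨w, hw⟩ := ((hG₁ y t).map f₁.toHom).exists_walk_length_eq_dist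
  obtain ⟨s, hs, hle⟩ := h.exists_dist_le_length hG₁ w hz y rfl
  exact (hy s hs).trans (hle.trans hw.le)

end IsAmalgam

lemma convexIn_singleton {V : Type*} (G : SimpleGraph V) (v : V) : ConvexIn G {v} := by
  refine ⟨?_, ?_⟩
  · have : Nonempty ({v} : Set V) := ⟨⟨v, rfl⟩⟩
    exact ⟨Preconnected.of_subsingleton⟩
  · rintro u rfl v rfl p hp x hx
    rw [G.dist_self, Walk.length_eq_zero_iff] at hp
    rw [Walk.nil_iff_support_eq.mp hp] at hx
    simpa using hx

lemma convexIn_univ {V : Type*} {G : SimpleGraph V} (hG : G.Connected) : ConvexIn G Set.univ :=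
  ⟨(induceUnivIso G).connected_iff.mpr hG, fun _ _ _ _ _ _ _ _ => Set.mem_univ _⟩

/-- Gluing two connected graphs at a single vertex. -/
lemma exists_amalgam_at_vertex {V₁ V₂ : Type*} [Finite V₁] [Finite V₂] {G₁ : SimpleGraph V₁}
    {G₂ : SimpleGraph V₂} (h₁ : G₁.Connected) (h₂ : G₂.Connected) (r : V₁) (u : V₂) :
    ∃ (W : Type) (A : SimpleGraph W) (f₁ : G₁ ↪g A) (f₂ : G₂ ↪g A),
      Finite W ∧ IsAmalgam G₁ G₂ A f₁ f₂ ∧ f₁ r = f₂ u ∧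
        coverDist A (Set.range ⇑f₁ ∩ Set.range ⇑f₂) ≤ max (ecc G₁ r) (ecc G₂ u) := by
  obtain ⟨n, ⟨e⟩⟩ := Finite.exists_equiv_fin {x : V₁ × V₂ // x.1 = r ∨ x.2 = u}
  let g₁ : V₁ ↪ Fin n := ⟨fun a => e ⟨(a, u), Or.inr rfl⟩, fun a a' h => by simpa using h⟩
  let g₂ : V₂ ↪ Fin n := ⟨fun b => e ⟨(r, b), Or.inl rfl⟩, fun b b' h => by simpa using h⟩
  have hmeet : ∀ a b, g₁ a = g₂ b ↔ a = r ∧ b = u := fun a b => by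
    refine e.injective.eq_iff.trans ?_
    rw [Subtype.mk.injEq, Prod.mk.injEq, eq_comm (a := u)]
  have hcover : ∀ x, x ∈ Set.range g₁ ∨ x ∈ Set.range g₂ := fun x => by
    obtain ⟨⟨⟨a, b⟩, rfl | rfl⟩, rfl⟩ := e.surjective x
    · exact Or.inr ⟨b, rfl⟩
    · exact Or.inl ⟨a, rfl⟩
  let A : SimpleGraph (Fin n) := G₁.map g₁ ⊔ G₂.map g₂
  have hA : ∀ x y, A.Adj x y ↔ (∃ a a', G₁.Adj a a' ∧ g₁ a = x ∧ g₁ a' = y) ∨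
      ∃ b b', G₂.Adj b b' ∧ g₂ b = x ∧ g₂ b' = y := fun x y => by
    simp [A, SimpleGraph.map_adj]
  let f₁ : G₁ ↪g A := ⟨g₁, fun {a a'} => by
    rw [hA]
    constructor
    · rintro (⟨b, b', hadj, h, h'⟩ | ⟨b, b', hadj, h, h'⟩)
      · rwa [← g₁.injective h, ← g₁.injective h']
      · obtain ⟨-, rfl⟩ := (hmeet _ _).mp h.symm
        obtain ⟨-, rfl⟩ := (hmeet _ _).mp h'.symm
        exact absurd hadj (G₂.irrefl)
    · exact fun h => Or.inl ⟨a, a', h, rfl, rfl⟩⟩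
  let f₂ : G₂ ↪g A := ⟨g₂, fun {a a'} => by
    rw [hA]
    constructor
    · rintro (⟨b, b', hadj, h, h'⟩ | ⟨b, b', hadj, h, h'⟩)
      · obtain ⟨rfl, -⟩ := (hmeet _ _).mp h
        obtain ⟨rfl, -⟩ := (hmeet _ _).mp h'
        exact absurd hadj (G₁.irrefl)
      · rwa [← g₂.injective h, ← g₂.injective h']
    · exact fun h => Or.inr ⟨a, a', h, rfl, rfl⟩⟩
  have hroot : f₁ r = f₂ u := (hmeet r u).mpr ⟨rfl, rfl⟩
  have hmem : f₁ r ∈ Set.range ⇑f₁ ∩ Set.range ⇑f₂ := ⟨⟨r, rfl⟩, ⟨u, hroot.symm⟩⟩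
  refine ⟨Fin n, A, f₁, f₂, inferInstance, ⟨?_, ?_, ?_, ?_⟩, hroot, ?_⟩
  · exact Set.eq_univ_of_forall hcover
  · intro x y hxy
    rcases (hA x y).mp hxy with ⟨a, a', -, rfl, rfl⟩ | ⟨a, a', -, rfl, rfl⟩
    · exact Or.inl ⟨⟨a, rfl⟩, ⟨a', rfl⟩⟩
    · exact Or.inr ⟨⟨a, rfl⟩, ⟨a', rfl⟩⟩
  · convert convexIn_singleton G₁ r
    ext a
    constructor
    · rintro ⟨b, hb⟩
      exact ((hmeet a b).mp hb.symm).1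
    · rintro rfl
      exact ⟨u, hroot.symm⟩
  · convert convexIn_singleton G₂ u
    ext b
    constructor
    · rintro ⟨a, ha⟩
      exact ((hmeet a b).mp ha).2
    · rintro rfl
      exact ⟨r, hroot⟩
  · refine csSup_le' ?_
    rintro _ ⟨x, rfl⟩
    refine (distToSet_le A x hmem).trans ?_
    rcases hcover x with ⟨a, rfl⟩ | ⟨b, rfl⟩
    · refine le_max_of_le_left ((dist_map_le h₁ f₁ a r).trans ?_)
      rw [G₁.dist_comm]
      exact dist_le_ecc G₁ r a
    · rw [hroot]
      refine le_max_of_le_right ((dist_map_le h₂ f₂ b u).trans ?_)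
      rw [G₂.dist_comm]
      exact dist_le_ecc G₂ u b

lemma topDownDist_le {V₁ V₂ : Type*} {G₁ : SimpleGraph V₁} {G₂ : SimpleGraph V₂} {r : V₁} {u : V₂}
    {W : Type} [Finite W] {A : SimpleGraph W} {f₁ : G₁ ↪g A} {f₂ : G₂ ↪g A}
    (h : IsAmalgam G₁ G₂ A f₁ f₂) (hroot : f₁ r = f₂ u) :
    topDownDist G₁ r G₂ u ≤ coverDist A (Set.range ⇑f₁ ∩ Set.range ⇑f₂) :=
  Nat.sInf_le ⟨W, A, f₁, f₂, inferInstance, h, hroot, rfl⟩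

lemma topDownDist_iso_eq_zero {V₁ V₂ : Type*} [Finite V₁] {G₁ : SimpleGraph V₁}
    {G₂ : SimpleGraph V₂} (h₁ : G₁.Connected) (φ : G₁ ≃g G₂) (r : V₁) :
    topDownDist G₁ r G₂ (φ r) = 0 := by
  obtain ⟨n, ⟨e⟩⟩ := Finite.exists_equiv_fin V₁
  let i : G₁ ≃g G₁.map e.toEmbedding := Iso.map e G₁
  let f₁ : G₁ ↪g G₁.map e.toEmbedding := i.toEmbedding
  let f₂ : G₂ ↪g G₁.map e.toEmbedding := SimpleGraph.Iso.toEmbedding (φ.symm.trans i)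
  have hf₁ : Set.range ⇑f₁ = Set.univ := i.surjective.range_eq
  have hf₂ : Set.range ⇑f₂ = Set.univ := (φ.symm.trans i).surjective.range_eq
  have hroot : f₁ r = f₂ (φ r) := congrArg i (φ.symm_apply_apply r).symm
  have h : IsAmalgam G₁ G₂ _ f₁ f₂ := by
    refine ⟨by simp [hf₁], fun x y _ => by simp [hf₁], ?_, ?_⟩
    · rw [hf₂, Set.preimage_univ]
      exact convexIn_univ h₁
    · rw [hf₁, Set.preimage_univ]
      exact convexIn_univ (φ.connected_iff.mp h₁)
  refine Nat.le_zero.mp ((topDownDist_le h hroot).trans (csSup_le' ?_))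
  rintro _ ⟨x, rfl⟩
  exact (distToSet_le _ x (s := x) (by simp [hf₁, hf₂])).trans (by simp)

/-- for non-trivial finite trees with `diam T₁ ≥ diam T₂` and a central
vertex `r₁` of `T₁`, the Hausdorff distance of `T₁` and `T₂` is the minimum, over all
vertices `u` of `T₂`, of the distance between the covers of an optimal top-down amalgam
of `T₁` rooted at `r₁` and `T₂` rooted at `u`. -/
theorem hausdorffDist_eq_min_topDownDist {V₁ V₂ : Type*} [Fintype V₁] [Fintype V₂]
    (T₁ : SimpleGraph V₁) (T₂ : SimpleGraph V₂)
    (h₁ : T₁.IsTree) (h₂ : T₂.IsTree)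
    (hn₁ : 1 < Fintype.card V₁) (hn₂ : 1 < Fintype.card V₂)
    (hdiam : gdiam T₂ ≤ gdiam T₁)
    (r₁ : V₁) (hr : ecc T₁ r₁ = grad T₁) :
    hausdorffDist T₁ T₂ = sInf (Set.range fun u : V₂ => topDownDist T₁ r₁ T₂ u) := by
  have hne₂ := h₂.connected.nonempty
  have hmin : ∀ u, sInf (Set.range fun u : V₂ => topDownDist T₁ r₁ T₂ u) ≤
      topDownDist T₁ r₁ T₂ u := fun u => Nat.sInf_le ⟨u, rfl⟩
  by_cases hiso : Nonempty (T₁ ≃g T₂)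
  · obtain ⟨φ⟩ := hiso
    have h0 := hmin (φ r₁)
    rw [topDownDist_iso_eq_zero h₁.connected φ r₁] at h0
    rw [hausdorffDist, if_pos ⟨φ⟩]
    omega
  rw [hausdorffDist, if_neg hiso]
  apply le_antisymm
  · obtain ⟨u, hu⟩ :=
      Nat.sInf_mem (Set.range_nonempty fun u : V₂ => topDownDist T₁ r₁ T₂ u)
    rw [← hu]
    obtain ⟨W, A, f₁, f₂, hW, hA, hroot, -⟩ :=
      exists_amalgam_at_vertex h₁.connected h₂.connected r₁ u
    refine le_csInf ⟨_, W, A, f₁, f₂, hW, hA, hroot, rfl⟩ ?_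
    rintro _ ⟨W, A, f₁, f₂, hW, hA, -, rfl⟩
    exact Nat.sInf_le ⟨W, A, f₁, f₂, hW, hA, rfl⟩
  · obtain ⟨c, hc⟩ := exists_ecc_eq_grad T₂
    obtain ⟨W₀, A₀, g₁, g₂, hW₀, hA₀, hroot₀, hle⟩ :=
      exists_amalgam_at_vertex h₁.connected h₂.connected r₁ c
    refine le_csInf ⟨_, W₀, A₀, g₁, g₂, hW₀, hA₀, rfl⟩ ?_
    rintro _ ⟨W, A, f₁, f₂, hW, hA, rfl⟩
    by_cases hmem : r₁ ∈ ⇑f₁ ⁻¹' Set.range ⇑f₂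
    · obtain ⟨u, hu⟩ := hmem
      exact (hmin u).trans (topDownDist_le hA hu.symm)
    · obtain ⟨y, hy⟩ := hA.conv₁.exists_forall_grad_le_dist h₁ hr hmem
      have hlow := hA.le_coverDist h₁.connected hy
      have hrad : grad T₂ ≤ grad T₁ := by
        have ha := two_mul_grad_le h₂
        have hb := gdiam_le_two_mul_ecc h₁.connected r₁
        omega
      rw [hr, hc, max_eq_left hrad] at hle
      exact (hmin c).trans ((topDownDist_le hA₀ hroot₀).trans (hle.trans hlow))
end HDTrees
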